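/- arXiv:0912.0106 — 2 statements merged into one kernel-verified Lean document; each statement's English description precedes it below -/
import Mathlib

section
/- Fix a real number q with 0 < q < 1 and define the q-number [x]_q := (q^x − q^{−x})/(q − q^{−1}) for x ∈ ℝ. Then for every real ε > 0, both series ∑_{n=1}^∞ (n+1)³ · ( (2/[2]_q)·[n]_q·[n+2]_q )^{−ε} and ∑_{n=1}^∞ (1/2)·n·(n+3)·(2n+3) · ( [n+1]_q·[n+2]_q )^{−ε} converge. -/
open Real

/-- The q-analogue `[x]_q = (q^x - q^{-x})/(q - q^{-1})` of a real number `x`. -/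
noncomputable def qNum (q x : ℝ) : ℝ := (q ^ x - q ^ (-x)) / (q - q⁻¹)

theorem rpow_one_sub_le_qNum {q x : ℝ} (hq0 : 0 < q) (hq1 : q < 1) (hx : 1 ≤ x) :
    q ^ (1 - x) ≤ qNum q x := by
  have hinv : q - q⁻¹ < 0 := by linarith [(one_lt_inv₀ hq0).2 hq1]
  have hle : q ^ x ≤ q ^ (2 - x) :=
    rpow_le_rpow_of_exponent_ge hq0 hq1.le (by linarith)
  have h₁ : q ^ (1 - x) * q = q ^ (2 - x) := by
    rw [← rpow_add_one hq0.ne']; ring_nf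
  have h₂ : q ^ (1 - x) * q⁻¹ = q ^ (-x) := by
    rw [← rpow_neg_one, ← rpow_add hq0]; ring_nf
  rw [qNum, le_div_iff_of_neg hinv, mul_sub, h₁, h₂]
  linarith

theorem summable_polynomial_eval_mul_geometric (p : Polynomial ℝ) {r : ℝ} (hr0 : 0 ≤ r)
    (hr1 : r < 1) : Summable fun n : ℕ => p.eval (n : ℝ) * r ^ n := by
  have hpow (k : ℕ) : Summable fun n : ℕ => (n : ℝ) ^ k * r ^ n :=
    summable_pow_mul_geometric_of_norm_lt_one k (by rwa [norm_of_nonneg hr0])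
  simp only [Polynomial.eval_eq_sum_range, Finset.sum_mul, mul_assoc]
  exact summable_sum fun k _ => (hpow k).mul_left _

theorem qNum_product_rpow_neg_le {q ε c a b : ℝ} (hq0 : 0 < q) (hq1 : q < 1) (hε : 0 < ε)
    (hc : 0 < c) (ha : 1 ≤ a) (hb : 1 ≤ b) (n : ℕ) :
    (c * qNum q (n + a) * qNum q (n + b)) ^ (-ε) ≤ c ^ (-ε) * (q ^ ε) ^ n := by
  have hn : (0 : ℝ) ≤ n := n.cast_nonneg
  have hA : q ^ (-(n : ℝ)) ≤ qNum q (n + a) :=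
    (rpow_le_rpow_of_exponent_ge hq0 hq1.le (by linarith)).trans
      (rpow_one_sub_le_qNum hq0 hq1 (by linarith))
  have hB : 1 ≤ qNum q (n + b) :=
    (one_le_rpow_of_pos_of_le_one_of_nonpos hq0 hq1.le (by linarith)).trans
      (rpow_one_sub_le_qNum hq0 hq1 (by linarith))
  have hpos : 0 < q ^ (-(n : ℝ)) := rpow_pos_of_pos hq0 _
  have hbase : c * q ^ (-(n : ℝ)) ≤ c * qNum q (n + a) * qNum q (n + b) :=
    (mul_le_mul_of_nonneg_left hA hc.le).trans
      (le_mul_of_one_le_right (mul_pos hc (hpos.trans_le hA)).le hB)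
  calc (c * qNum q (n + a) * qNum q (n + b)) ^ (-ε)
      ≤ (c * q ^ (-(n : ℝ))) ^ (-ε) :=
        rpow_le_rpow_of_nonpos (mul_pos hc hpos) hbase (by linarith)
    _ = c ^ (-ε) * (q ^ ε) ^ n := by
        rw [mul_rpow hc.le hpos.le, ← rpow_mul hq0.le, ← rpow_natCast, ← rpow_mul hq0.le]
        ring_nf

theorem summable_polynomial_eval_mul_qNum_product_rpow_neg (p : Polynomial ℝ)
    {q ε c a b : ℝ} (hq0 : 0 < q) (hq1 : q < 1) (hε : 0 < ε)
    (hc : 0 < c) (ha : 1 ≤ a) (hb : 1 ≤ b) :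
    Summable fun n : ℕ =>
      p.eval (n : ℝ) * (c * qNum q (n + a) * qNum q (n + b)) ^ (-ε) := by
  have hqNum {x : ℝ} (hx : 1 ≤ x) : 0 < qNum q x :=
    (rpow_pos_of_pos hq0 _).trans_le (rpow_one_sub_le_qNum hq0 hq1 hx)
  have hgeom := (summable_polynomial_eval_mul_geometric p (rpow_nonneg hq0.le ε)
    (rpow_lt_one hq0.le hq1 hε)).norm.mul_left (c ^ (-ε))
  refine Summable.of_norm_bounded hgeom fun n => ?_
  have hn : (0 : ℝ) ≤ n := n.cast_nonneg
  have hbase : 0 ≤ c * qNum q (n + a) * qNum q (n + b) :=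
    (mul_pos (mul_pos hc (hqNum (by linarith))) (hqNum (by linarith))).le
  rw [norm_mul, norm_mul, norm_of_nonneg (rpow_nonneg hbase _),
    norm_of_nonneg (pow_nonneg (rpow_nonneg hq0.le ε) n), mul_left_comm]
  exact mul_le_mul_of_nonneg_left (qNum_product_rpow_neg_le hq0 hq1 hε hc ha hb n)
    (norm_nonneg _)

/-- For `0 < q < 1` and every `ε > 0`, the series
`∑_{n≥1} (n+1)³ ((2/[2]_q)[n]_q[n+2]_q)^{-ε}` and
`∑_{n≥1} ½ n(n+3)(2n+3) ([n+1]_q[n+2]_q)^{-ε}` converge: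
the Dirac operator on `ℂP²_q` is `0⁺`-summable. -/
theorem dirac_zero_plus_summable (q : ℝ) (hq0 : 0 < q) (hq1 : q < 1)
    (ε : ℝ) (hε : 0 < ε) :
    Summable (fun n : ℕ =>
      ((n : ℝ) + 2) ^ 3 *
        ((2 / qNum q 2) * qNum q ((n : ℝ) + 1) * qNum q ((n : ℝ) + 3)) ^ (-ε)) ∧
    Summable (fun n : ℕ =>
      (1 / 2) * ((n : ℝ) + 1) * ((n : ℝ) + 4) * (2 * ((n : ℝ) + 1) + 3) *
        (qNum q ((n : ℝ) + 2) * qNum q ((n : ℝ) + 3)) ^ (-ε)) := by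
  have htwo : 0 < qNum q 2 :=
    (rpow_pos_of_pos hq0 _).trans_le (rpow_one_sub_le_qNum hq0 hq1 one_le_two)
  constructor
  · have h := summable_polynomial_eval_mul_qNum_product_rpow_neg
      ((Polynomial.X + Polynomial.C 2 : Polynomial ℝ) ^ 3) hq0 hq1 hε (div_pos two_pos htwo)
      (le_refl 1) (by norm_num : (1 : ℝ) ≤ 3)
    refine h.congr fun n => ?_
    congr 1
    simp
  · have h := summable_polynomial_eval_mul_qNum_product_rpow_neg
      (Polynomial.C (1 / 2) * (Polynomial.X + Polynomial.C 1) * (Polynomial.X + Polynomial.C 4) *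
        (Polynomial.C 2 * (Polynomial.X + Polynomial.C 1) + Polynomial.C 3) : Polynomial ℝ)
      hq0 hq1 hε one_pos one_le_two (by norm_num : (1 : ℝ) ≤ 3)
    refine h.congr fun n => ?_
    rw [one_mul]
    congr 1
    simp
end

section
/- Fix a real number q with 0 < q < 1 and define [x]_q := (q^x − q^{−x})/(q − q^{−1}). For n ∈ ℕ and N ∈ ℤ set λ_{n,N} := (1+q^{−3})·[n]_q·[n+N+2]_q + [2]_q·[N]_q if N ≥ 0, and λ_{n,N} := (1+q^{−3})·[n+2]_q·[n−N]_q + [2]_q·[N]_q if N ≤ 0. Then λ_{n,N} ≥ 0 for all n ∈ ℕ and N ∈ ℤ, and λ_{n,N} = 0 if and only if n = 0 and N = 0. -/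
open Real

/-- The eigenvalues `λ_{n,N}` of the gauged Laplacian `□_N` on the charge-`N`
line bundle over `ℂP²_q`. -/
noncomputable def gaugedLaplacianEV (q : ℝ) (n : ℕ) (N : ℤ) : ℝ :=
  if 0 ≤ N then
    (1 + q ^ (-3 : ℝ)) * qNum q (n : ℝ) * qNum q ((n : ℝ) + (N : ℝ) + 2)
      + qNum q 2 * qNum q (N : ℝ)
  else
    (1 + q ^ (-3 : ℝ)) * qNum q ((n : ℝ) + 2) * qNum q ((n : ℝ) - (N : ℝ))
      + qNum q 2 * qNum q (N : ℝ)

theorem qNum_zero (q : ℝ) : qNum q 0 = 0 := by simp [qNum]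

theorem qNum_neg (q x : ℝ) : qNum q (-x) = -qNum q x := by
  rw [qNum, qNum, neg_neg, ← neg_div, neg_sub]

theorem qNum_strictMono {q : ℝ} (hq0 : 0 < q) (hq1 : q < 1) : StrictMono (qNum q) := by
  intro x y hxy
  have hden : q - q⁻¹ < 0 := by linarith [(one_lt_inv₀ hq0).2 hq1]
  have h1 : q ^ y < q ^ x := Real.rpow_lt_rpow_of_exponent_gt hq0 hq1 hxy
  have h2 : q ^ (-x) < q ^ (-y) :=
    Real.rpow_lt_rpow_of_exponent_gt hq0 hq1 (neg_lt_neg hxy)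
  exact div_lt_div_of_neg_of_lt hden (by linarith)

theorem qNum_pos {q x : ℝ} (hq0 : 0 < q) (hq1 : q < 1) (hx : 0 < x) : 0 < qNum q x :=
  qNum_zero q ▸ qNum_strictMono hq0 hq1 hx

theorem qNum_nonneg {q x : ℝ} (hq0 : 0 < q) (hq1 : q < 1) (hx : 0 ≤ x) : 0 ≤ qNum q x :=
  qNum_zero q ▸ (qNum_strictMono hq0 hq1).monotone hx

theorem gaugedLaplacianEV_zero_zero (q : ℝ) : gaugedLaplacianEV q 0 0 = 0 := by
  simp [gaugedLaplacianEV, qNum_zero]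

theorem gaugedLaplacianEV_pos {q : ℝ} (hq0 : 0 < q) (hq1 : q < 1) {n : ℕ} {N : ℤ}
    (h : ¬(n = 0 ∧ N = 0)) : 0 < gaugedLaplacianEV q n N := by
  have hc : 0 < q ^ (-3 : ℝ) := Real.rpow_pos_of_pos hq0 _
  have hn : (0 : ℝ) ≤ n := n.cast_nonneg
  have h2 : 0 < qNum q 2 := qNum_pos hq0 hq1 two_pos
  rw [gaugedLaplacianEV]
  split_ifs with hN
  · have hN' : (0 : ℝ) ≤ N := by exact_mod_cast hN
    have hsum : 0 < qNum q ((n : ℝ) + N + 2) := qNum_pos hq0 hq1 (by linarith)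
    rcases Nat.eq_zero_or_pos n with rfl | hn0
    · have hNpos : (0 : ℝ) < N := by
        exact_mod_cast lt_of_le_of_ne hN fun hN0 => h ⟨rfl, hN0.symm⟩
      have := qNum_pos hq0 hq1 hNpos
      rw [Nat.cast_zero, qNum_zero]
      simpa using mul_pos h2 this
    · have hnq : 0 < qNum q n := qNum_pos hq0 hq1 (by exact_mod_cast hn0)
      have hNq : 0 ≤ qNum q N := qNum_nonneg hq0 hq1 hN'
      positivity
  · have hN' : (N : ℝ) < 0 := by exact_mod_cast not_le.1 hN
    have hNq : 0 < qNum q (-N) := qNum_pos hq0 hq1 (by linarith)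
    have hmono := (qNum_strictMono hq0 hq1).monotone
    have hle : qNum q 2 * qNum q (-N) ≤ qNum q (n + 2) * qNum q (n - N) :=
      mul_le_mul (hmono (by linarith)) (hmono (by linarith)) hNq.le
        (qNum_nonneg hq0 hq1 (by linarith))
    have hprod : 0 < qNum q (n + 2) * qNum q (n - N) := (mul_pos h2 hNq).trans_le hle
    rw [qNum_neg] at hle
    linarith [mul_pos hc hprod]

/-- For `0 < q < 1`, the eigenvalues `λ_{n,N}` of the gauged Laplacian `□_N` are
nonnegative, and `λ_{n,N} = 0` if and only if `n = 0` and `N = 0`. -/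
theorem gaugedLaplacianEV_nonneg_and_eq_zero_iff
    (q : ℝ) (hq0 : 0 < q) (hq1 : q < 1) :
    ∀ (n : ℕ) (N : ℤ),
      0 ≤ gaugedLaplacianEV q n N ∧
      (gaugedLaplacianEV q n N = 0 ↔ n = 0 ∧ N = 0) := by
  intro n N
  by_cases h : n = 0 ∧ N = 0
  · obtain ⟨rfl, rfl⟩ := h
    simp [gaugedLaplacianEV_zero_zero]
  · have hpos := gaugedLaplacianEV_pos hq0 hq1 h
    exact ⟨hpos.le, fun h0 => absurd h0 hpos.ne', fun h0 => absurd h0 h⟩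
end
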